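/- arXiv:2409.15480 — 4 statements merged into one kernel-verified Lean document; each statement's English description precedes it below -/
import Mathlib

section
/- For every positive integer n and all distinct irrational reals ξ, ξ', μ_n(ξ,ξ') = max over positive divisors g of n of μ(g·ξ, g·ξ'), as an identity in the extended reals [0,∞]. -/
/-- The `n`-Markoff quality of a pair `(s,t)` for `(ξ,ξ')`:
`gcd(t,n)·|ξ − ξ'| / (|s − tξ|·|s − tξ'|)`, valued in `[0,∞]`. -/
noncomputable def muQuality (n : ℕ) (ξ ξ' : ℝ) (st : ℤ × ℤ) : ENNReal :=
  ENNReal.ofReal ((Int.gcd st.2 n : ℝ) * |ξ - ξ'| /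
    (|(st.1 : ℝ) - (st.2 : ℝ) * ξ| * |(st.1 : ℝ) - (st.2 : ℝ) * ξ'|))

/-- The `n`-Markoff approximability `μ_n(ξ,ξ')`, valued in `[0,∞]`. -/
noncomputable def muN (n : ℕ) (ξ ξ' : ℝ) : ENNReal :=
  ⨆ st ∈ {st : ℤ × ℤ | st ≠ 0}, muQuality n ξ ξ' st

/-- The `n`-Markoff spectrum: the set of finite real values of `μ_n`
over pairs of distinct irrationals. -/
def MarkoffSpectrum (n : ℕ) : Set ℝ :=
  {α : ℝ | ∃ ξ ξ' : ℝ, Irrational ξ ∧ Irrational ξ' ∧ ξ ≠ ξ' ∧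
    muN n ξ ξ' ≠ ⊤ ∧ (muN n ξ ξ').toReal = α}

theorem muQuality_one_natCast_mul (g : ℕ) (ξ ξ' : ℝ) (s t : ℤ) :
    muQuality 1 (g * ξ) (g * ξ') (s, t) =
      ENNReal.ofReal (g * |ξ - ξ'| /
        (|(s : ℝ) - ((g * t : ℤ) : ℝ) * ξ| * |(s : ℝ) - ((g * t : ℤ) : ℝ) * ξ'|)) := by
  simp only [muQuality, ← mul_sub, abs_mul, Nat.abs_cast]
  push_cast
  simp [mul_assoc, mul_left_comm]

theorem muQuality_one_natCast_mul_le {n g : ℕ} (hn : 0 < n) (hg : g ∣ n) (ξ ξ' : ℝ) (s t : ℤ) :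
    muQuality 1 (g * ξ) (g * ξ') (s, t) ≤ muQuality n ξ ξ' (s, g * t) := by
  have hle : g ≤ Int.gcd (g * t) n :=
    Nat.le_of_dvd (Int.gcd_pos_of_ne_zero_right _ (by exact_mod_cast hn.ne'))
      (Int.dvd_gcd (dvd_mul_right _ _) (by exact_mod_cast hg))
  rw [muQuality_one_natCast_mul]
  unfold muQuality
  gcongr

theorem muQuality_gcd_mul {n g : ℕ} (ξ ξ' : ℝ) (s t : ℤ) (hg : Int.gcd (g * t) n = g) :
    muQuality n ξ ξ' (s, g * t) = muQuality 1 (g * ξ) (g * ξ') (s, t) := by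
  rw [muQuality_one_natCast_mul, muQuality, hg]

theorem stmt_3 (n : ℕ) (hn : 0 < n) (ξ ξ' : ℝ) (hξ : Irrational ξ)
    (hξ' : Irrational ξ') (hne : ξ ≠ ξ') :
    muN n ξ ξ' = n.divisors.sup fun g => muN 1 ((g : ℝ) * ξ) ((g : ℝ) * ξ') := by
  apply le_antisymm
  · refine iSup₂_le fun ⟨s, t⟩ hst => ?_
    have hdvd : Int.gcd t n ∣ n := by exact_mod_cast Int.gcd_dvd_right t n
    obtain ⟨t', ht'⟩ : (Int.gcd t n : ℤ) ∣ t := Int.gcd_dvd_left t n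
    have hst' : (s, t') ≠ 0 := by
      rintro h
      obtain ⟨rfl, rfl⟩ := Prod.mk_eq_zero.mp h
      exact hst (Prod.mk_eq_zero.mpr ⟨rfl, by simpa using ht'⟩)
    have key : muQuality n ξ ξ' (s, t) =
        muQuality 1 ((Int.gcd t n : ℕ) * ξ) ((Int.gcd t n : ℕ) * ξ') (s, t') := by
      rw [← muQuality_gcd_mul (n := n) ξ ξ' s t' (by rw [← ht']), ← ht']
    rw [key]
    exact (le_iSup₂_of_le (s, t') hst' le_rfl).trans
      (Finset.le_sup (f := fun g : ℕ => muN 1 ((g : ℝ) * ξ) ((g : ℝ) * ξ'))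
        (Nat.mem_divisors.mpr ⟨hdvd, hn.ne'⟩))
  · refine Finset.sup_le fun g hg => iSup₂_le fun ⟨s, t⟩ hst => ?_
    have hgn := Nat.dvd_of_mem_divisors hg
    have hg0 : (g : ℤ) ≠ 0 := by exact_mod_cast (Nat.pos_of_mem_divisors hg).ne'
    refine le_iSup₂_of_le (s, g * t) (fun h => hst ?_)
      (muQuality_one_natCast_mul_le hn hgn ξ ξ' s t)
    obtain ⟨hs, ht⟩ := Prod.mk_eq_zero.mp h
    exact Prod.mk_eq_zero.mpr ⟨hs, (mul_eq_zero.mp ht).resolve_left hg0⟩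
end

section
/- For every positive integer n, every α ∈ ℳ_n can be realized as α = μ_n(ξ,ξ') for some distinct irrational reals ξ, ξ' for which the supremum defining μ_n(ξ,ξ') is attained at some (s,t) ∈ ℤ² \ {(0,0)}. -/
open Filter Topology

/-- The binary quadratic form `A x² + B x y + C y²`. -/
def binaryForm (A B C x y : ℝ) : ℝ := A * x ^ 2 + B * x * y + C * y ^ 2

theorem exists_tendsto_ultrafilter_of_abs_le {ι : Type*} (U : Ultrafilter ι) {f : ι → ℝ} {M : ℝ}
    (hf : ∀ i, |f i| ≤ M) : ∃ x, Tendsto f U (𝓝 x) := by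
  obtain ⟨x, -, hx⟩ := (isCompact_Icc (a := -M) (b := M)).ultrafilter_le_nhds (U.map f)
    (le_principal_iff.2 (Ultrafilter.mem_map.2 (univ_mem' fun i ↦ abs_le.1 (hf i))))
  exact ⟨x, hx⟩

theorem exists_eventually_eq_ultrafilter {ι β : Type*} [Finite β] (U : Ultrafilter ι)
    (f : ι → β) : ∃ b, ∀ᶠ i in U, f i = b := by
  by_contra! h
  have h' : ∀ᶠ i in (U : Filter ι), ∀ b, f i ≠ b :=
    eventually_all.2 h
  obtain ⟨i, hi⟩ := h'.exists
  exact hi _ rfl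

theorem gcd_mul_le {g n : ℕ} (hg : g ≠ 0) (hn : n ≠ 0) (t : ℤ) :
    Int.gcd (g * t) n ≤ g * Int.gcd t n := by
  have h : Int.gcd (g * t) (g * n) = g * Int.gcd t n := by simp [Int.gcd_mul_left]
  rw [← h]
  refine Nat.le_of_dvd ?_ (Int.gcd_dvd_gcd_mul_left_right _ _ _)
  rw [h]
  exact Nat.mul_pos (Nat.pos_of_ne_zero hg)
    (Int.gcd_pos_of_ne_zero_right t (by exact_mod_cast hn))

/-- A determinant one substitution with given first column makes the middle coefficient small. -/
theorem exists_reduced_substitution {A B C : ℝ} {s t : ℤ} (hst : IsCoprime s t)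
    (h0 : binaryForm A B C s t ≠ 0) :
    ∃ r u : ℤ, s * u - r * t = 1 ∧
      |2 * A * s * r + B * (s * u + r * t) + 2 * C * t * u| ≤ |binaryForm A B C s t| := by
  obtain ⟨p, q, hpq⟩ := hst
  set a := binaryForm A B C s t with ha
  set b := 2 * A * s * (-q : ℤ) + B * (s * p + (-q : ℤ) * t) + 2 * C * t * p with hb
  have hr := abs_sub_round (b / (2 * a))
  set m := round (b / (2 * a))
  refine ⟨-q - m * s, p - m * t, by linear_combination hpq, ?_⟩
  have e : 2 * A * s * ((-q - m * s : ℤ) : ℝ) + B * (s * ((p - m * t : ℤ) : ℝ)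
      + ((-q - m * s : ℤ) : ℝ) * t) + 2 * C * t * ((p - m * t : ℤ) : ℝ)
      = (2 * a) * (b / (2 * a) - m) := by
    have : (2 * a) * (b / (2 * a) - m) = b - 2 * a * m := by field_simp
    rw [this, ha, hb, binaryForm]
    push_cast
    ring
  rw [e, abs_mul, abs_mul, abs_two]
  nlinarith [abs_nonneg a]

/-- A compactness principle: the optimal constant in `gcd(t,n) ≤ α |f(s,t)|` for an indefinite
binary form of discriminant one is attained by some form of discriminant one. -/
theorem exists_extremal_binaryForm {n : ℕ} (hn : 0 < n) {α : ℝ} (hα : 0 < α) {A B C : ℝ}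
    (hdisc : B ^ 2 - 4 * A * C = 1)
    (hle : ∀ s t : ℤ, (s, t) ≠ 0 → (Int.gcd t n : ℝ) ≤ α * |binaryForm A B C s t|)
    (happrox : ∀ β < α, ∃ s t : ℤ, IsCoprime s t ∧
      β * |binaryForm A B C s t| < Int.gcd t n) :
    ∃ A' B' C' : ℝ, B' ^ 2 - 4 * A' * C' = 1 ∧
      (∀ s t : ℤ, (s, t) ≠ 0 → (Int.gcd t n : ℝ) ≤ α * |binaryForm A' B' C' s t|) ∧
      ∃ s t : ℤ, (s, t) ≠ 0 ∧ (Int.gcd t n : ℝ) = α * |binaryForm A' B' C' s t| := by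
  have gcd_pos (t : ℤ) : (1 : ℝ) ≤ Int.gcd t n := by
    exact_mod_cast Int.gcd_pos_of_ne_zero_right t (by exact_mod_cast hn.ne')
  have gcd_le (t : ℤ) : (Int.gcd t n : ℝ) ≤ n := by
    exact_mod_cast Nat.le_of_dvd hn (by simpa using Int.gcd_dvd_natAbs_right t n)
  have key (k : ℕ) : ∃ s t r u : ℤ, s * u - r * t = 1 ∧
      |2 * A * s * r + B * (s * u + r * t) + 2 * C * t * u| ≤ |binaryForm A B C s t| ∧
      α * (1 - 1 / (k + 2)) * |binaryForm A B C s t| < Int.gcd t n := by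
    have hk : (0 : ℝ) < 1 / (k + 2) := by positivity
    obtain ⟨s, t, hco, hlt⟩ := happrox (α * (1 - 1 / (k + 2))) (by nlinarith)
    have hne : (s, t) ≠ 0 := by
      rintro h
      simp only [Prod.mk_eq_zero] at h
      exact not_isCoprime_zero_zero (by rwa [h.1, h.2] at hco)
    have h0 : binaryForm A B C s t ≠ 0 := by
      intro h
      have := hle s t hne
      rw [h, abs_zero, mul_zero] at this
      linarith [gcd_pos t]
    obtain ⟨r, u, h1, h2⟩ := exists_reduced_substitution hco h0
    exact ⟨s, t, r, u, h1, h2, hlt⟩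
  choose s t r u hdet hb ha using key
  set a : ℕ → ℝ := fun k ↦ binaryForm A B C (s k) (t k) with ha_def
  set b : ℕ → ℝ := fun k ↦
    2 * A * s k * r k + B * (s k * u k + r k * t k) + 2 * C * t k * u k with hb_def
  set c : ℕ → ℝ := fun k ↦ binaryForm A B C (r k) (u k) with hc_def
  have hsub (k : ℕ) (x y : ℝ) : binaryForm (a k) (b k) (c k) x y =
      binaryForm A B C (s k * x + r k * y) (t k * x + u k * y) := by
    simp only [binaryForm, ha_def, hb_def, hc_def]
    ring
  have hdetR (k : ℕ) : (s k * u k - r k * t k : ℝ) = 1 := by exact_mod_cast hdet k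
  have hdisc' (k : ℕ) : b k ^ 2 - 4 * a k * c k = 1 := by
    have : b k ^ 2 - 4 * a k * c k = (B ^ 2 - 4 * A * C) * (s k * u k - r k * t k) ^ 2 := by
      simp only [binaryForm, ha_def, hb_def, hc_def]
      ring
    rw [this, hdisc, hdetR]
    norm_num
  have hle' (k : ℕ) (x y : ℤ) (hxy : (x, y) ≠ 0) :
      (Int.gcd (t k * x + u k * y) n : ℝ) ≤ α * |binaryForm (a k) (b k) (c k) x y| := by
    rw [hsub]
    have := hle (s k * x + r k * y) (t k * x + u k * y) ?_
    · simpa using this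
    · intro h
      simp only [Prod.mk_eq_zero] at h
      apply hxy
      simp only [Prod.mk_eq_zero]
      constructor
      · linear_combination u k * h.1 - r k * h.2 - x * hdet k
      · linear_combination s k * h.2 - t k * h.1 - y * hdet k
  have ha_lower (k : ℕ) : 1 ≤ α * |a k| := by
    have := hle' k 1 0 (by simp)
    simp only [binaryForm] at this
    norm_num at this
    exact (gcd_pos _).trans this
  have ha_upper (k : ℕ) : |a k| ≤ 2 * n / α := by
    have h1 : (1 : ℝ) / (k + 2) ≤ 1 / 2 := by gcongr; linarith [k.cast_nonneg (α := ℝ)]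
    have h2 : α * (1 / 2) * |a k| ≤ α * (1 - 1 / (k + 2)) * |a k| := by gcongr; linarith
    rw [le_div_iff₀ hα]
    linarith [ha k, gcd_le (t k)]
  have hb_upper (k : ℕ) : |b k| ≤ 2 * n / α := (hb k).trans (ha_upper k)
  have hc_upper (k : ℕ) : |c k| ≤ ((2 * n / α) ^ 2 + 1) * α := by
    have h1 : 4 * (|a k| * |c k|) ≤ (2 * n / α) ^ 2 + 1 := by
      have : 4 * (|a k| * |c k|) = |b k ^ 2 - 1| := by
        rw [← abs_mul, ← abs_of_pos (four_pos (α := ℝ)), ← abs_mul]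
        congr 1
        linear_combination - hdisc' k
      rw [this]
      have h3 : b k ^ 2 ≤ (2 * n / α) ^ 2 := sq_le_sq' (abs_le.1 (hb_upper k)).1
        (abs_le.1 (hb_upper k)).2
      rw [abs_le]
      constructor <;> nlinarith [sq_nonneg (b k)]
    nlinarith [mul_le_mul_of_nonneg_right (ha_lower k) (abs_nonneg (c k)), abs_nonneg (c k),
      mul_nonneg (abs_nonneg (a k)) (abs_nonneg (c k))]
  let U : Ultrafilter ℕ := hyperfilter ℕ
  have hU : (U : Filter ℕ) ≤ atTop := Nat.hyperfilter_le_atTop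
  obtain ⟨a₀, ha₀⟩ := exists_tendsto_ultrafilter_of_abs_le U ha_upper
  obtain ⟨b₀, hb₀⟩ := exists_tendsto_ultrafilter_of_abs_le U hb_upper
  obtain ⟨c₀, hc₀⟩ := exists_tendsto_ultrafilter_of_abs_le U hc_upper
  have : NeZero n := ⟨hn.ne'⟩
  obtain ⟨⟨t₀, u₀⟩, htu⟩ :=
    exists_eventually_eq_ultrafilter U fun k ↦ ((t k : ZMod n), (u k : ZMod n))
  obtain ⟨j, hj⟩ := htu.exists
  have hweight : ∀ᶠ k in U, ∀ x y : ℤ,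
      Int.gcd (t k * x + u k * y) n = Int.gcd (t j * x + u j * y) n := by
    filter_upwards [htu] with k hk x y
    rw [← hj, Prod.mk.injEq, ZMod.intCast_eq_intCast_iff, ZMod.intCast_eq_intCast_iff] at hk
    rw [← Int.gcd_emod, (hk.1.mul_right x).add (hk.2.mul_right y), Int.gcd_emod]
  have hlim (x y : ℝ) : Tendsto (fun k ↦ α * |binaryForm (a k) (b k) (c k) x y|) U
      (𝓝 (α * |binaryForm a₀ b₀ c₀ x y|)) := by
    unfold binaryForm
    exact ((((ha₀.mul_const _).add ((hb₀.mul_const _).mul_const _)).add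
      (hc₀.mul_const _)).abs).const_mul _
  have hdisc₀ : b₀ ^ 2 - 4 * a₀ * c₀ = 1 := by
    refine tendsto_nhds_unique (((hb₀.pow 2).sub ((ha₀.const_mul 4).mul hc₀))) ?_
    simp only [hdisc']
    exact tendsto_const_nhds
  have hle₀ (x y : ℤ) (hxy : (x, y) ≠ 0) :
      (Int.gcd (t j * x + u j * y) n : ℝ) ≤ α * |binaryForm a₀ b₀ c₀ x y| := by
    refine ge_of_tendsto (hlim x y) ?_
    filter_upwards [hweight] with k hk
    rw [← hk]
    exact hle' k x y hxy
  have hge₀ : α * |a₀| ≤ Int.gcd (t j) n := by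
    have h1 : Tendsto (fun k : ℕ ↦ α * (1 - 1 / ((k : ℝ) + 2)) * |a k|) U
        (𝓝 (α * (1 - 0) * |a₀|)) := by
      refine ((tendsto_const_nhds.sub ?_).const_mul α).mul ha₀.abs
      refine Tendsto.mono_left ?_ hU
      exact tendsto_const_nhds.div_atTop
        (tendsto_atTop_add_const_right _ _ tendsto_natCast_atTop_atTop)
    rw [sub_zero, mul_one] at h1
    refine le_of_tendsto h1 ?_
    filter_upwards [hweight] with k hk
    have := hk 1 0
    simp only [mul_one, mul_zero, add_zero] at this
    rw [← this]
    exact (ha k).le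
  have hinv (x y : ℝ) : binaryForm
      (binaryForm a₀ b₀ c₀ (u j) (-t j))
      (-2 * a₀ * u j * r j + b₀ * (u j * s j + r j * t j) - 2 * c₀ * t j * s j)
      (binaryForm a₀ b₀ c₀ (-r j) (s j)) x y =
      binaryForm a₀ b₀ c₀ (u j * x - r j * y) (-t j * x + s j * y) := by
    simp only [binaryForm]
    ring
  refine ⟨binaryForm a₀ b₀ c₀ (u j) (-t j),
    -2 * a₀ * u j * r j + b₀ * (u j * s j + r j * t j) - 2 * c₀ * t j * s j,
    binaryForm a₀ b₀ c₀ (-r j) (s j), ?_, fun x y hxy ↦ ?_, s j, t j, ?_, ?_⟩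
  · have : (-2 * a₀ * u j * r j + b₀ * (u j * s j + r j * t j) - 2 * c₀ * t j * s j) ^ 2
        - 4 * binaryForm a₀ b₀ c₀ (u j) (-t j) * binaryForm a₀ b₀ c₀ (-r j) (s j)
        = (b₀ ^ 2 - 4 * a₀ * c₀) * (s j * u j - r j * t j : ℝ) ^ 2 := by
      simp only [binaryForm]
      ring
    rw [this, hdisc₀, hdetR]
    norm_num
  · rw [hinv]
    have := hle₀ (u j * x - r j * y) (-t j * x + s j * y) ?_
    · convert this using 2
      · congr 2
        linear_combination (-y) * hdet j
      · push_cast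
        rfl
    · intro h
      simp only [Prod.mk_eq_zero] at h
      apply hxy
      simp only [Prod.mk_eq_zero]
      constructor
      · linear_combination s j * h.1 + r j * h.2 - x * hdet j
      · linear_combination t j * h.1 + u j * h.2 - y * hdet j
  · intro h
    simp only [Prod.mk_eq_zero] at h
    have := hdet j
    simp [h.1, h.2] at this
  · rw [hinv]
    have e1 : (u j * s j - r j * t j : ℝ) = 1 := by linear_combination hdetR j
    have e2 : (-t j * s j + s j * t j : ℝ) = 0 := by ring
    rw [e1, e2]
    have h1 := hle₀ 1 0 (by simp)
    simp only [binaryForm] at h1 ⊢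
    norm_num at h1 ⊢
    exact le_antisymm h1 hge₀

/-- The form of discriminant one with a given ordered pair of distinct roots. -/
noncomputable def rootForm (ξ ξ' x y : ℝ) : ℝ := (x - y * ξ) * (x - y * ξ') / (ξ - ξ')

theorem rootForm_eq_binaryForm (ξ ξ' x y : ℝ) : rootForm ξ ξ' x y =
    binaryForm (1 / (ξ - ξ')) (-(ξ + ξ') / (ξ - ξ')) (ξ * ξ' / (ξ - ξ')) x y := by
  simp only [rootForm, binaryForm]
  ring

theorem muQuality_eq (n : ℕ) (ξ ξ' : ℝ) (st : ℤ × ℤ) :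
    muQuality n ξ ξ' st = ENNReal.ofReal (Int.gcd st.2 n / |rootForm ξ ξ' st.1 st.2|) := by
  rw [muQuality, rootForm, abs_div, abs_mul, div_div_eq_mul_div]

theorem sub_mul_ne_zero_of_irrational {ξ : ℝ} (hξ : Irrational ξ) {s t : ℤ}
    (h : (s, t) ≠ 0) : (s - t * ξ : ℝ) ≠ 0 := by
  intro h0
  rcases eq_or_ne t 0 with rfl | ht
  · apply h
    simpa using h0
  · exact (hξ.intCast_mul ht).ne_int s (by linarith)

theorem rootForm_ne_zero {ξ ξ' : ℝ} (hξ : Irrational ξ) (hξ' : Irrational ξ') (hne : ξ ≠ ξ')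
    {s t : ℤ} (h : (s, t) ≠ 0) : rootForm ξ ξ' s t ≠ 0 :=
  div_ne_zero (mul_ne_zero (sub_mul_ne_zero_of_irrational hξ h)
    (sub_mul_ne_zero_of_irrational hξ' h)) (sub_ne_zero.2 hne)

theorem rootForm_mul (ξ ξ' g x y : ℝ) :
    rootForm ξ ξ' (g * x) (g * y) = g ^ 2 * rootForm ξ ξ' x y := by
  simp only [rootForm]
  ring

/-- Every strict lower bound of the approximability is exceeded by a primitive pair. -/
theorem exists_isCoprime_lt {n : ℕ} (hn : n ≠ 0) {ξ ξ' α : ℝ} (hξ : Irrational ξ) (hξ' : Irrational ξ')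
    (hne : ξ ≠ ξ') (hα : muN n ξ ξ' = ENNReal.ofReal α) (β : ℝ) (hβ : β < α) (hα0 : 0 < α) :
    ∃ s t : ℤ, IsCoprime s t ∧ β * |rootForm ξ ξ' s t| < Int.gcd t n := by
  have h : ENNReal.ofReal β < muN n ξ ξ' := by
    rw [hα]
    exact (ENNReal.ofReal_lt_ofReal_iff hα0).2 hβ
  simp only [muN, lt_iSup_iff] at h
  obtain ⟨⟨s, t⟩, hst, hlt⟩ := h
  have hpos : 0 < |rootForm ξ ξ' s t| := abs_pos.2 (rootForm_ne_zero hξ hξ' hne hst)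
  rw [muQuality_eq] at hlt
  have hlt := (ENNReal.ofReal_lt_ofReal_iff').1 hlt
  have hlt := (lt_div_iff₀ hpos).1 hlt.1
  have hg : (Int.gcd s t : ℤ) ≠ 0 := by
    intro h
    rw [Int.natCast_eq_zero, Int.gcd_eq_zero_iff] at h
    exact hst (by simp [h.1, h.2])
  obtain ⟨s', hs⟩ := Int.gcd_dvd_left s t
  obtain ⟨t', ht⟩ := Int.gcd_dvd_right s t
  set g := Int.gcd s t with hg_def
  refine ⟨s', t', ?_, ?_⟩
  · rw [Int.isCoprime_iff_gcd_eq_one]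
    have h : Int.gcd (g * s') (g * t') = g := by rw [← hs, ← ht]
    rw [Int.gcd_mul_left, Int.natAbs_natCast] at h
    exact Nat.eq_of_mul_eq_mul_left (Nat.pos_of_ne_zero (by exact_mod_cast hg))
      (h.trans (mul_one g).symm)
  · have h1 : 1 ≤ (g : ℝ) := by exact_mod_cast Nat.one_le_iff_ne_zero.2 (by exact_mod_cast hg)
    have h2 : (Int.gcd t n : ℝ) ≤ g * Int.gcd t' n := by
      rw [ht]
      exact_mod_cast gcd_mul_le (by exact_mod_cast hg) hn t'
    have h3 : |rootForm ξ ξ' s t| = g ^ 2 * |rootForm ξ ξ' s' t'| := by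
      rw [hs, ht]
      push_cast
      rw [rootForm_mul, abs_mul, abs_of_nonneg (by positivity)]
    rw [h3] at hlt
    have h4 : 0 ≤ (Int.gcd t' n : ℝ) := by positivity
    have h5 : g * (g * (β * |rootForm ξ ξ' s' t'|)) < g * (Int.gcd t' n : ℝ) := by nlinarith
    have h6 := lt_of_mul_lt_mul_left h5 (by positivity)
    nlinarith

/-- A form of discriminant one without nontrivial integral zeros is the form of two irrationals. -/
theorem exists_irrational_roots {A B C : ℝ} (hdisc : B ^ 2 - 4 * A * C = 1)
    (h0 : ∀ s t : ℤ, (s, t) ≠ 0 → binaryForm A B C s t ≠ 0) :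
    ∃ ξ ξ' : ℝ, Irrational ξ ∧ Irrational ξ' ∧ ξ ≠ ξ' ∧
      ∀ x y, rootForm ξ ξ' x y = binaryForm A B C x y := by
  have hA : A ≠ 0 := by
    have := h0 1 0 (by simp)
    simpa [binaryForm] using this
  have hirr (z : ℝ) (hz : A * z ^ 2 + B * z + C = 0) : Irrational z := by
    rintro ⟨q, rfl⟩
    apply h0 q.num q.den (by simp)
    have hd : (q.den : ℝ) ≠ 0 := by exact_mod_cast q.den_ne_zero
    have hq : (q.num : ℝ) = q * q.den := by exact_mod_cast (Rat.mul_den_eq_num q).symm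
    rw [binaryForm, hq]
    push_cast
    linear_combination (q.den : ℝ) ^ 2 * hz
  refine ⟨(-B + 1) / (2 * A), (-B - 1) / (2 * A), hirr _ ?_, hirr _ ?_, ?_, fun x y ↦ ?_⟩
  · field_simp
    linear_combination -hdisc
  · field_simp
    linear_combination -hdisc
  · intro h
    field_simp at h
    linarith
  · have : (-B + 1) / (2 * A) - (-B - 1) / (2 * A) = 1 / A := by field_simp; ring
    rw [rootForm, this, binaryForm]
    field_simp
    linear_combination y ^ 2 * hdisc

theorem stmt_6 (n : ℕ) (hn : 0 < n) :
    ∀ α ∈ MarkoffSpectrum n, ∃ ξ ξ' : ℝ, Irrational ξ ∧ Irrational ξ' ∧ ξ ≠ ξ' ∧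
      muN n ξ ξ' ≠ ⊤ ∧ (muN n ξ ξ').toReal = α ∧
      ∃ st : ℤ × ℤ, st ≠ 0 ∧ muQuality n ξ ξ' st = muN n ξ ξ' := by
  rintro α ⟨ξ, ξ', hξ, hξ', hne, hfin, hα⟩
  have hmu : muN n ξ ξ' = ENNReal.ofReal α := by rw [← hα, ENNReal.ofReal_toReal hfin]
  have gcd_pos (t : ℤ) : (0 : ℝ) < Int.gcd t n := by
    exact_mod_cast Int.gcd_pos_of_ne_zero_right t (by exact_mod_cast hn.ne')
  have hq (st : ℤ × ℤ) (h : st ≠ 0) : muQuality n ξ ξ' st ≤ ENNReal.ofReal α := by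
    rw [← hmu]
    exact le_iSup₂ (f := fun st (_ : st ∈ {st : ℤ × ℤ | st ≠ 0}) ↦ muQuality n ξ ξ' st) st h
  have hα0 : 0 < α := by
    refine ENNReal.ofReal_pos.1 (lt_of_lt_of_le ?_ (hq (1, 0) (by simp)))
    rw [muQuality_eq]
    exact ENNReal.ofReal_pos.2
      (div_pos (gcd_pos _) (abs_pos.2 (rootForm_ne_zero hξ hξ' hne (by simp))))
  have hsub : ξ - ξ' ≠ 0 := sub_ne_zero.2 hne
  obtain ⟨A, B, C, hdisc, hle, s, t, hst, heq⟩ := exists_extremal_binaryForm hn hα0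
    (A := 1 / (ξ - ξ')) (B := -(ξ + ξ') / (ξ - ξ')) (C := ξ * ξ' / (ξ - ξ'))
    (by field_simp; ring)
    (fun s t hst ↦ by
      have := hq (s, t) hst
      rw [muQuality_eq, ENNReal.ofReal_le_ofReal_iff hα0.le,
        div_le_iff₀ (abs_pos.2 (rootForm_ne_zero hξ hξ' hne hst))] at this
      rwa [← rootForm_eq_binaryForm])
    (fun β hβ ↦ by
      simp only [← rootForm_eq_binaryForm]
      exact exists_isCoprime_lt hn.ne' hξ hξ' hne hmu β hβ hα0)
  have h0 (s t : ℤ) (hst : (s, t) ≠ 0) : 0 < |binaryForm A B C s t| :=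
    pos_of_mul_pos_right ((gcd_pos t).trans_le (hle s t hst)) hα0.le
  obtain ⟨η, η', hη, hη', hηne, hform⟩ :=
    exists_irrational_roots hdisc fun s t hst ↦ abs_pos.1 (h0 s t hst)
  have hmax : muQuality n η η' (s, t) = ENNReal.ofReal α := by
    rw [muQuality_eq, hform, heq, mul_div_cancel_right₀ _ (h0 s t hst).ne']
  have hmu' : muN n η η' = ENNReal.ofReal α := by
    refine le_antisymm (iSup₂_le fun st hst ↦ ?_) ?_
    · rw [muQuality_eq, hform]
      exact ENNReal.ofReal_le_ofReal ((div_le_iff₀ (h0 _ _ hst)).2 (hle _ _ hst))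
    · rw [← hmax]
      exact le_iSup₂ (f := fun st (_ : st ∈ {st : ℤ × ℤ | st ≠ 0}) ↦ muQuality n η η' st)
        (s, t) hst
  refine ⟨η, η', hη, hη', hηne, ?_, ?_, (s, t), hst, ?_⟩
  · rw [hmu']
    exact ENNReal.ofReal_ne_top
  · rw [hmu', ENNReal.toReal_ofReal hα0.le]
  · rw [hmax, hmu']
end

section
/- For every positive integer n, the n-Markoff spectrum ℳ_n is a closed subset of ℝ. -/
open Filter Topology

/-- The binary quadratic form `a x² + b x y + c y²`. -/
noncomputable def binForm (a b c x y : ℝ) : ℝ := a * x ^ 2 + b * x * y + c * y ^ 2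

theorem one_le_gcd_natCast {n : ℕ} (hn : 0 < n) (t : ℤ) : (1 : ℝ) ≤ Int.gcd t n := by
  exact_mod_cast Int.gcd_pos_of_ne_zero_right t (by exact_mod_cast hn.ne')

theorem gcd_natCast_le {n : ℕ} (hn : 0 < n) (t : ℤ) : (Int.gcd t n : ℝ) ≤ n := by
  exact_mod_cast Nat.le_of_dvd hn (by simpa using Int.gcd_dvd_natAbs_right t n)

theorem gcd_congr_of_zmod_eq {n : ℕ} {u v : ℤ} (h : (u : ZMod n) = v) :
    Int.gcd u n = Int.gcd v n := by
  rw [← Int.gcd_emod u, (ZMod.intCast_eq_intCast_iff' _ _ _).1 h, Int.gcd_emod]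

theorem int_pair_ne_zero {s t : ℤ} : ((s, t) : ℤ × ℤ) ≠ 0 ↔ s ≠ 0 ∨ t ≠ 0 := by
  rw [Ne, Prod.mk_eq_zero]; tauto

theorem Irrational.sub_mul_ne_zero {ξ : ℝ} (h : Irrational ξ) {s t : ℤ}
    (hst : s ≠ 0 ∨ t ≠ 0) : (s : ℝ) - t * ξ ≠ 0 := by
  intro h0
  by_cases ht : t = 0
  · subst ht
    have : s = 0 := by simpa using h0
    tauto
  · refine (h.intCast_mul ht).ne_int s ?_
    linarith

/-- The value `μ_n(ξ,ξ') = α`, without division or suprema. -/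
theorem muN_eq_iff {n : ℕ} {ξ ξ' α : ℝ} (h : Irrational ξ) (h' : Irrational ξ')
    (hα : 0 ≤ α) :
    muN n ξ ξ' = ENNReal.ofReal α ↔
      (∀ s t : ℤ, s ≠ 0 ∨ t ≠ 0 →
        Int.gcd t n * |ξ - ξ'| ≤ α * (|(s : ℝ) - t * ξ| * |(s : ℝ) - t * ξ'|)) ∧
      ∀ β < α, 0 ≤ β → ∃ s t : ℤ, (s ≠ 0 ∨ t ≠ 0) ∧
        β * (|(s : ℝ) - t * ξ| * |(s : ℝ) - t * ξ'|) < Int.gcd t n * |ξ - ξ'| := by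
  have hpos : ∀ s t : ℤ, s ≠ 0 ∨ t ≠ 0 → 0 < |(s : ℝ) - t * ξ| * |(s : ℝ) - t * ξ'| :=
    fun s t hst => mul_pos (abs_pos.2 (h.sub_mul_ne_zero hst)) (abs_pos.2 (h'.sub_mul_ne_zero hst))
  have hle : muN n ξ ξ' ≤ ENNReal.ofReal α ↔ ∀ s t : ℤ, s ≠ 0 ∨ t ≠ 0 →
        Int.gcd t n * |ξ - ξ'| ≤ α * (|(s : ℝ) - t * ξ| * |(s : ℝ) - t * ξ'|) := by
    simp only [muN, iSup_le_iff, Prod.forall, Set.mem_ofPred_eq, int_pair_ne_zero, muQuality]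
    refine forall_congr' fun s => forall_congr' fun t => forall_congr' fun hst => ?_
    rw [ENNReal.ofReal_le_ofReal_iff hα, div_le_iff₀ (hpos s t hst)]
  have hge : ENNReal.ofReal α ≤ muN n ξ ξ' ↔ ∀ β < α, 0 ≤ β → ∃ s t : ℤ, (s ≠ 0 ∨ t ≠ 0) ∧
        β * (|(s : ℝ) - t * ξ| * |(s : ℝ) - t * ξ'|) < Int.gcd t n * |ξ - ξ'| := by
    have key : ∀ β : ℝ, 0 ≤ β → (ENNReal.ofReal β < muN n ξ ξ' ↔
        ∃ s t : ℤ, (s ≠ 0 ∨ t ≠ 0) ∧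
          β * (|(s : ℝ) - t * ξ| * |(s : ℝ) - t * ξ'|) < Int.gcd t n * |ξ - ξ'|) := by
      intro β hβ
      simp only [muN, lt_iSup_iff, Prod.exists, Set.mem_ofPred_eq, int_pair_ne_zero, muQuality,
        exists_prop]
      refine exists_congr fun s => exists_congr fun t => and_congr_right fun hst => ?_
      rw [ENNReal.ofReal_lt_ofReal_iff_of_nonneg hβ, lt_div_iff₀ (hpos s t hst)]
    constructor
    · intro H β hβα hβ
      exact (key β hβ).1
        (((ENNReal.ofReal_lt_ofReal_iff_of_nonneg hβ).2 hβα).trans_le H)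
    · intro H
      refine le_of_forall_lt fun c hc => ?_
      have hc' : c ≠ ⊤ := (hc.trans_le le_top).ne
      have hcr : ENNReal.ofReal c.toReal = c := ENNReal.ofReal_toReal hc'
      rw [← hcr] at hc ⊢
      exact (key _ ENNReal.toReal_nonneg).2
        (H _ ((ENNReal.ofReal_lt_ofReal_iff_of_nonneg ENNReal.toReal_nonneg).1 hc)
          ENNReal.toReal_nonneg)
  rw [le_antisymm_iff, hle, hge]

theorem mem_markoffSpectrum_iff {n : ℕ} {α : ℝ} :
    α ∈ MarkoffSpectrum n ↔ 0 ≤ α ∧ ∃ ξ ξ' : ℝ, Irrational ξ ∧ Irrational ξ' ∧ ξ ≠ ξ' ∧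
      muN n ξ ξ' = ENNReal.ofReal α := by
  constructor
  · rintro ⟨ξ, ξ', h, h', hne, hT, rfl⟩
    exact ⟨ENNReal.toReal_nonneg, ξ, ξ', h, h', hne, (ENNReal.ofReal_toReal hT).symm⟩
  · rintro ⟨h0, ξ, ξ', h, h', hne, hμ⟩
    exact ⟨ξ, ξ', h, h', hne, by simp [hμ], by simp [hμ, h0]⟩

/-- By Dirichlet's theorem, forms of discriminant one take small values. -/
theorem exists_abs_mul_abs_le {ξ ξ' : ℝ} (hne : ξ ≠ ξ') :
    ∃ s t : ℤ, t ≠ 0 ∧ |(s : ℝ) - t * ξ| * |(s : ℝ) - t * ξ'| ≤ 2 * |ξ - ξ'| := by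
  have hD : 0 < |ξ - ξ'| := abs_pos.2 (sub_ne_zero.2 hne)
  obtain ⟨N, hN⟩ := exists_nat_one_div_lt hD
  obtain ⟨j, k, hk, hkN, hjk⟩ := Real.exists_int_int_abs_mul_sub_le ξ (Nat.succ_pos N)
  refine ⟨j, k, hk.ne', ?_⟩
  have hk' : (0 : ℝ) < k := by exact_mod_cast hk
  have hkN' : (k : ℝ) ≤ N + 1 := by exact_mod_cast hkN
  have hN0 : (0 : ℝ) < (N : ℝ) + 1 := by positivity
  have h1 : |(j : ℝ) - k * ξ| ≤ 1 / (N + 1) := by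
    rw [abs_sub_comm]
    refine hjk.trans (one_div_le_one_div_of_le hN0 ?_)
    push_cast; linarith
  have h2 : |(j : ℝ) - k * ξ'| ≤ 1 / (N + 1) + (N + 1) * |ξ - ξ'| := by
    have : (j : ℝ) - k * ξ' = (j - k * ξ) + k * (ξ - ξ') := by ring
    rw [this]
    refine (abs_add_le _ _).trans (add_le_add h1 ?_)
    rw [abs_mul, abs_of_pos hk']
    gcongr
  have h3 : (1 : ℝ) / (N + 1) ≤ 1 := by
    rw [div_le_one hN0]; linarith [Nat.cast_nonneg (α := ℝ) N]
  have h4 : (0 : ℝ) < 1 / (N + 1) := by positivity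
  calc |(j : ℝ) - k * ξ| * |(j : ℝ) - k * ξ'|
      ≤ 1 / (N + 1) * (1 / (N + 1) + (N + 1) * |ξ - ξ'|) := by gcongr
    _ = 1 / (N + 1) * (1 / (N + 1)) + |ξ - ξ'| := by field_simp
    _ ≤ 2 * |ξ - ξ'| := by nlinarith

/-- Elements of the spectrum in terms of forms of discriminant one. -/
theorem exists_form_of_mem {n : ℕ} (hn : 0 < n) {α : ℝ} (hα : α ∈ MarkoffSpectrum n) :
    1 / 2 ≤ α ∧ ∃ a b c : ℝ, b ^ 2 - 4 * a * c = 1 ∧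
      (∀ s t : ℤ, s ≠ 0 ∨ t ≠ 0 → Int.gcd t n ≤ α * |binForm a b c s t|) ∧
      ∀ β < α, 0 ≤ β → ∃ s t : ℤ, (s ≠ 0 ∨ t ≠ 0) ∧ β * |binForm a b c s t| < Int.gcd t n := by
  obtain ⟨h0, ξ, ξ', h, h', hne, hμ⟩ := mem_markoffSpectrum_iff.1 hα
  rw [muN_eq_iff h h' h0] at hμ
  obtain ⟨h1, h2⟩ := hμ
  have hD : 0 < |ξ - ξ'| := abs_pos.2 (sub_ne_zero.2 hne)
  refine ⟨?_, 1 / |ξ - ξ'|, -(ξ + ξ') / |ξ - ξ'|, ξ * ξ' / |ξ - ξ'|, ?_, ?_⟩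
  · obtain ⟨s, t, ht, hst⟩ := exists_abs_mul_abs_le hne
    have h3 := h1 s t (Or.inr ht)
    have h4 := one_le_gcd_natCast hn t
    have h5 := mul_le_mul_of_nonneg_left hst h0
    have h6 := mul_le_mul_of_nonneg_right h4 hD.le
    by_contra! h7
    nlinarith
  · field_simp
    rw [sq_abs]; ring
  · have hQ : ∀ s t : ℤ,
        |binForm (1 / |ξ - ξ'|) (-(ξ + ξ') / |ξ - ξ'|) (ξ * ξ' / |ξ - ξ'|) s t| =
        |(s : ℝ) - t * ξ| * |(s : ℝ) - t * ξ'| / |ξ - ξ'| := by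
      intro s t
      rw [← abs_mul, ← abs_abs (ξ - ξ'), ← abs_div, abs_abs, binForm]
      congr 1
      field_simp
      ring
    simp only [hQ, ← mul_div_assoc, le_div_iff₀ hD, div_lt_iff₀ hD]
    exact ⟨h1, h2⟩

theorem mem_of_form {n : ℕ} (hn : 0 < n) {α a b c : ℝ} (h0 : 0 ≤ α)
    (hdisc : b ^ 2 - 4 * a * c = 1)
    (h1 : ∀ s t : ℤ, s ≠ 0 ∨ t ≠ 0 → Int.gcd t n ≤ α * |binForm a b c s t|)
    (h2 : ∀ β < α, 0 ≤ β → ∃ s t : ℤ, (s ≠ 0 ∨ t ≠ 0) ∧ β * |binForm a b c s t| < Int.gcd t n) :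
    α ∈ MarkoffSpectrum n := by
  have hne : ∀ s t : ℤ, s ≠ 0 ∨ t ≠ 0 → binForm a b c s t ≠ 0 := by
    intro s t hst hz
    have := h1 s t hst
    have h3 := one_le_gcd_natCast hn t
    rw [hz] at this
    simp only [abs_zero, mul_zero] at this
    linarith
  have ha : a ≠ 0 := by simpa [binForm] using hne 1 0 (by simp)
  have hfac : ∀ s t : ℝ, binForm a b c s t =
      a * ((s - t * ((-b + 1) / (2 * a))) * (s - t * ((-b - 1) / (2 * a)))) := by
    intro s t
    have hc : c = (b ^ 2 - 1) / (4 * a) := by field_simp; linarith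
    rw [binForm, hc]
    field_simp
    ring
  have hirr : ∀ ξ : ℝ, (∀ s t : ℝ, s - t * ξ = 0 → binForm a b c s t = 0) → Irrational ξ := by
    rintro ξ hξ ⟨q, rfl⟩
    refine hne q.num q.den (Or.inr (by exact_mod_cast q.den_nz)) ?_
    have := hξ q.num q.den (by
      have h := Rat.den_mul_eq_num q
      have h' : ((q.den : ℚ) : ℝ) * (q : ℝ) = ((q.num : ℚ) : ℝ) := by exact_mod_cast h
      push_cast at h'
      linarith)
    exact_mod_cast this
  have hsub : (-b + 1) / (2 * a) - (-b - 1) / (2 * a) = 1 / a := by field_simp; ring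
  refine mem_markoffSpectrum_iff.2 ⟨h0, (-b + 1) / (2 * a), (-b - 1) / (2 * a),
    hirr _ fun s t h => by rw [hfac, h]; ring, hirr _ fun s t h => by rw [hfac, h]; ring, ?_, ?_⟩
  · rw [← sub_ne_zero, hsub]; exact one_div_ne_zero ha
  · rw [muN_eq_iff (hirr _ fun s t h => by rw [hfac, h]; ring)
      (hirr _ fun s t h => by rw [hfac, h]; ring) h0]
    have ha' : 0 < |a| := abs_pos.2 ha
    simp only [hfac, abs_mul] at h1 h2
    simp only [hsub, abs_div, abs_one, mul_one_div, div_le_iff₀ ha', lt_div_iff₀ ha']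
    refine ⟨fun s t hst => (h1 s t hst).trans_eq (by ring), fun β hβ hβ0 => ?_⟩
    obtain ⟨s, t, hst, h⟩ := h2 β hβ hβ0
    exact ⟨s, t, hst, h.trans_eq' (by ring)⟩

/-- A form close to attaining `α` can be moved by `SL₂(ℤ)` so that it nearly attains `α` at
`(1, 0)` and its middle coefficient is reduced. -/
theorem exists_reduced_form {n : ℕ} (hn : 0 < n) {α β : ℝ} (hα : α ∈ MarkoffSpectrum n)
    (hβα : β < α) (hβ : 0 < β) :
    ∃ (a b c : ℝ) (p q r s : ℤ), p * s - q * r = 1 ∧ b ^ 2 - 4 * a * c = 1 ∧ |b| ≤ |a| ∧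
      (∀ x y : ℤ, x ≠ 0 ∨ y ≠ 0 → Int.gcd (r * x + s * y) n ≤ α * |binForm a b c x y|) ∧
      β * |a| < Int.gcd r n := by
  obtain ⟨-, a, b, c, hdisc, h1, h2⟩ := exists_form_of_mem hn hα
  obtain ⟨s, t, hst, hlt⟩ := h2 β hβα hβ.le
  obtain ⟨p, r, u, v, hcop, hlt⟩ : ∃ p r u v : ℤ, p * u + r * v = 1 ∧
      β * |binForm a b c p r| < Int.gcd r n := by
    have hd : 0 < Int.gcd s t := Int.gcd_pos_iff.2 hst
    obtain ⟨p, hp⟩ := Int.gcd_dvd_left s t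
    obtain ⟨r, hr⟩ := Int.gcd_dvd_right s t
    refine ⟨p, r, Int.gcdA s t, Int.gcdB s t, ?_, ?_⟩
    · have := Int.gcd_eq_gcd_ab s t
      generalize Int.gcd s t = d, Int.gcdA s t = u, Int.gcdB s t = v at *
      have hd' : (d : ℤ) ≠ 0 := by exact_mod_cast hd.ne'
      apply mul_left_cancel₀ hd'
      linear_combination -this - u * hp - v * hr
    · generalize Int.gcd s t = d at *
      subst hp hr
      have hd1 : (1 : ℝ) ≤ d := by exact_mod_cast hd
      have hd0 : (0 : ℝ) < d := by linarith
      have hg : (Int.gcd (d * r) n : ℝ) ≤ d * Int.gcd r n := by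
        have : Int.gcd (d * r) n ∣ d * Int.gcd r n := by
          have h3 : Int.gcd (d * r) (d * n) = d * Int.gcd r n := by
            simp [Int.gcd_mul_left]
          rw [← h3]
          exact Int.gcd_dvd_gcd_mul_left_right _ _ _
        exact_mod_cast Nat.le_of_dvd (Nat.mul_pos hd
          (Int.gcd_pos_of_ne_zero_right r (by exact_mod_cast hn.ne'))) this
      have hQ : binForm a b c ((d * p : ℤ) : ℝ) ((d * r : ℤ) : ℝ) =
          d ^ 2 * binForm a b c p r := by
        simp only [binForm]; push_cast; ring
      rw [hQ, abs_mul, abs_of_pos (by positivity)] at hlt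
      have h4 : (d : ℝ) * (d * (β * |binForm a b c p r|)) < d * Int.gcd r n := by
        linarith
      have h5 := lt_of_mul_lt_mul_left h4 hd0.le
      have h6 : 0 ≤ β * |binForm a b c p r| := by positivity
      nlinarith
  have hA : binForm a b c p r ≠ 0 := by
    have hpr : p ≠ 0 ∨ r ≠ 0 := by
      by_contra! h
      simp [h.1, h.2] at hcop
    intro h
    have h3 := h1 p r hpr
    have h4 := one_le_gcd_natCast hn r
    rw [h] at h3
    simp only [abs_zero, mul_zero] at h3
    linarith
  set A := binForm a b c p r with hAdef
  set B₀ : ℝ := 2 * a * p * (-v) + b * (p * u + (-v) * r) + 2 * c * r * u with hB₀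
  set m : ℤ := -round (B₀ / (2 * A)) with hm
  have hcop' : (p : ℝ) * u + r * v = 1 := by exact_mod_cast hcop
  refine ⟨A, B₀ + 2 * A * m, binForm a b c (-v + p * m) (u + r * m), p, -v + p * m, r, u + r * m,
    ?_, ?_, ?_, ?_, hlt⟩
  · linear_combination hcop
  · have : (B₀ + 2 * A * m) ^ 2 - 4 * A * binForm a b c (-v + p * m) (u + r * m) =
        (b ^ 2 - 4 * a * c) * (p * u + r * v) ^ 2 := by
      simp only [hB₀, hAdef, binForm]; ring
    rw [this, hdisc, hcop']; norm_num
  · have h3 := abs_sub_round (B₀ / (2 * A))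
    have h4 : B₀ + 2 * A * m = 2 * A * (B₀ / (2 * A) - round (B₀ / (2 * A))) := by
      rw [hm]; push_cast; field_simp; ring
    rw [h4, abs_mul, abs_mul, abs_two]
    nlinarith [abs_nonneg A]
  · intro x y hxy
    have h3 := h1 (p * x + (-v + p * m) * y) (r * x + (u + r * m) * y) ?_
    · refine h3.trans_eq ?_
      congr 2
      simp only [hB₀, hAdef, binForm]; push_cast; ring
    · by_contra! h
      have hx : x = 0 := by
        linear_combination (u + r * m) * h.1 - (-v + p * m) * h.2 - x * hcop
      have hy : y = 0 := by
        linear_combination p * h.2 - r * h.1 - y * hcop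
      tauto

theorem Ultrafilter.exists_tendsto_of_abs_le {ι : Type*} (U : Ultrafilter ι) {f : ι → ℝ} {C : ℝ}
    (h : ∀ i, |f i| ≤ C) : ∃ x, Tendsto f U (𝓝 x) := by
  obtain ⟨x, -, hx⟩ := (isCompact_Icc (a := -C) (b := C)).ultrafilter_le_nhds (U.map f)
    (by
      rw [Ultrafilter.coe_map, le_principal_iff, Filter.mem_map]
      exact univ_mem' fun i => abs_le.1 (h i))
  exact ⟨x, hx⟩

theorem Ultrafilter.exists_eventually_eq {ι κ : Type*} [Finite κ] (U : Ultrafilter ι)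
    (f : ι → κ) : ∃ x, ∀ᶠ i in U, f i = x := by
  have h : ∀ᶠ i in U, ∃ x, f i = x := Eventually.of_forall fun i => ⟨_, rfl⟩
  exact Ultrafilter.eventually_exists_iff.1 h

theorem stmt_7 (n : ℕ) (hn : 0 < n) : IsClosed (MarkoffSpectrum n) := by
  refine IsSeqClosed.isClosed fun α α₀ hα hlim => ?_
  have : NeZero n := ⟨hn.ne'⟩
  have hhalf : ∀ k, 1 / 2 ≤ α k := fun k => (exists_form_of_mem hn (hα k)).1
  have hε : ∀ k : ℕ, (0 : ℝ) < 1 / (k + 4) ∧ (1 : ℝ) / (k + 4) ≤ 1 / 4 := fun k =>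
    ⟨by positivity,
      one_div_le_one_div_of_le (by norm_num) (by linarith [Nat.cast_nonneg (α := ℝ) k])⟩
  choose a b c p q r s hdet hdisc hba hle hlt using fun k =>
    exists_reduced_form hn (hα k) (β := α k - 1 / (k + 4)) (by linarith [(hε k).1])
      (by linarith [hhalf k, (hε k).2])
  obtain ⟨M, hM⟩ : ∃ M, ∀ k, α k ≤ M := by
    obtain ⟨M, hM⟩ := hlim.bddAbove_range
    exact ⟨M, fun k => hM ⟨k, rfl⟩⟩
  have ha : ∀ k, |a k| ≤ 4 * n := fun k => by
    have h1 := hlt k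
    have h2 := gcd_natCast_le hn (r k)
    have h3 : 1 / 4 * |a k| ≤ (α k - 1 / (k + 4)) * |a k| :=
      mul_le_mul_of_nonneg_right (by linarith [hhalf k, (hε k).2]) (abs_nonneg _)
    linarith
  have ha1 : ∀ k, 1 ≤ α k * |a k| := fun k => by
    have h1 := hle k 1 0 (by simp)
    have h2 := one_le_gcd_natCast hn (r k)
    norm_num [binForm] at h1
    linarith
  have hc : ∀ k, |c k| ≤ M * ((4 * n) ^ 2 + 1) := fun k => by
    have h1 : |4 * a k * c k| ≤ (4 * n) ^ 2 + 1 := by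
      have : 4 * a k * c k = b k ^ 2 - 1 := by linarith [hdisc k]
      have h2 : b k ^ 2 ≤ (4 * n) ^ 2 := by
        rw [← sq_abs]
        exact pow_le_pow_left₀ (abs_nonneg _) ((hba k).trans (ha k)) 2
      rw [this, abs_le]
      constructor <;> nlinarith [sq_nonneg (b k)]
    rw [abs_mul, abs_mul, abs_of_pos (by norm_num : (0 : ℝ) < 4)] at h1
    have h0 : 0 ≤ α k := by linarith [hhalf k]
    calc |c k| ≤ (α k * |a k|) * |c k| := le_mul_of_one_le_left (abs_nonneg _) (ha1 k)
      _ = α k * (|a k| * |c k|) := by ring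
      _ ≤ M * ((4 * n) ^ 2 + 1) := by
        have h2 : 0 ≤ |a k| * |c k| := by positivity
        exact mul_le_mul (hM k) (by linarith) h2 (h0.trans (hM k))
  let U : Ultrafilter ℕ := hyperfilter ℕ
  have hU : (U : Filter ℕ) ≤ atTop := Nat.hyperfilter_le_atTop
  have hlimU : Tendsto α U (𝓝 α₀) := hlim.mono_left hU
  obtain ⟨a₀, ha₀⟩ := U.exists_tendsto_of_abs_le ha
  obtain ⟨b₀, hb₀⟩ := U.exists_tendsto_of_abs_le fun k => (hba k).trans (ha k)
  obtain ⟨c₀, hc₀⟩ := U.exists_tendsto_of_abs_le hc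
  obtain ⟨z, hz⟩ := U.exists_eventually_eq fun k => ((r k : ZMod n), (s k : ZMod n))
  obtain ⟨k₀, hk₀⟩ := hz.exists
  have hgcd : ∀ᶠ k in U, ∀ x y : ℤ,
      Int.gcd (r k * x + s k * y) n = Int.gcd (r k₀ * x + s k₀ * y) n := by
    filter_upwards [hz] with k hk x y
    obtain ⟨h1, h2⟩ := Prod.ext_iff.1 (hk.trans hk₀.symm)
    apply gcd_congr_of_zmod_eq
    push_cast
    simp only at h1 h2
    rw [h1, h2]
  have hform : ∀ x y : ℝ,
      Tendsto (fun k => binForm (a k) (b k) (c k) x y) U (𝓝 (binForm a₀ b₀ c₀ x y)) := fun x y =>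
    ((ha₀.mul_const _).add ((hb₀.mul_const _).mul_const _)).add (hc₀.mul_const _)
  have hdisc₀ : b₀ ^ 2 - 4 * a₀ * c₀ = 1 := by
    refine tendsto_nhds_unique ((hb₀.pow 2).sub ((ha₀.const_mul 4).mul hc₀)) ?_
    simp only [hdisc]
    exact tendsto_const_nhds
  have hle₀ : ∀ x y : ℤ, x ≠ 0 ∨ y ≠ 0 →
      Int.gcd (r k₀ * x + s k₀ * y) n ≤ α₀ * |binForm a₀ b₀ c₀ x y| := fun x y hxy => by
    refine ge_of_tendsto (hlimU.mul (hform x y).abs) ?_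
    filter_upwards [hgcd] with k hk
    rw [← hk]
    exact hle k x y hxy
  have hattain : α₀ * |a₀| ≤ Int.gcd (r k₀) n := by
    have hε0 : Tendsto (fun k : ℕ => (1 : ℝ) / (k + 4)) U (𝓝 0) := by
      refine Tendsto.mono_left ?_ hU
      exact_mod_cast (tendsto_const_div_atTop_nhds_zero_nat (1 : ℝ)).comp (tendsto_add_atTop_nat 4)
    have h := (hlimU.sub hε0).mul ha₀.abs
    rw [sub_zero] at h
    refine le_of_tendsto h ?_
    filter_upwards [hgcd] with k hk
    have h1 := hk 1 0
    simp only [mul_one, mul_zero, add_zero] at h1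
    rw [← h1]
    exact (hlt k).le
  have hα₀ : 0 ≤ α₀ := le_trans (by norm_num) (ge_of_tendsto' hlim hhalf)
  have ha₀pos : 0 < |a₀| := by
    have h1 := hle₀ 1 0 (by simp)
    refine abs_pos.2 fun h => hn.ne' ?_
    norm_num [binForm, h] at h1
    exact h1.2
  have hd := hdet k₀
  generalize p k₀ = p, q k₀ = q, r k₀ = r, s k₀ = s at *
  have hd' : (p : ℝ) * s - q * r = 1 := by exact_mod_cast hd
  have hcomp : ∀ x y : ℝ, binForm (binForm a₀ b₀ c₀ s (-r))
      (2 * a₀ * s * (-q) + b₀ * (s * p + (-q) * (-r)) + 2 * c₀ * (-r) * p)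
      (binForm a₀ b₀ c₀ (-q) p) x y = binForm a₀ b₀ c₀ (s * x - q * y) (-r * x + p * y) := by
    intro x y
    simp only [binForm]; ring
  refine mem_of_form hn hα₀ (a := binForm a₀ b₀ c₀ s (-r))
    (b := 2 * a₀ * s * (-q) + b₀ * (s * p + (-q) * (-r)) + 2 * c₀ * (-r) * p)
    (c := binForm a₀ b₀ c₀ (-q) p) ?_ ?_ ?_
  · calc _ = (b₀ ^ 2 - 4 * a₀ * c₀) * (p * s - q * r) ^ 2 := by simp only [binForm]; ring
      _ = 1 := by rw [hdisc₀, hd']; norm_num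
  · intro x y hxy
    have h1 := hle₀ (s * x - q * y) (-r * x + p * y) ?_
    · have h2 : r * (s * x - q * y) + s * (-r * x + p * y) = y := by
        linear_combination y * hd
      rw [h2] at h1
      rw [hcomp]
      exact_mod_cast h1
    · by_contra! h
      have hx : x = 0 := by linear_combination p * h.1 + q * h.2 - x * hd
      have hy : y = 0 := by linear_combination r * h.1 + s * h.2 - y * hd
      tauto
  · intro β hβ _
    refine ⟨p, r, ?_, ?_⟩
    · by_contra! h
      simp [h.1, h.2] at hd
    · have h1 : (s : ℝ) * p - q * r = 1 := by linarith
      have h2 : -(r : ℝ) * p + p * r = 0 := by ring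
      rw [hcomp, h1, h2]
      have h3 : binForm a₀ b₀ c₀ 1 0 = a₀ := by simp [binForm]
      rw [h3]
      exact (mul_lt_mul_of_pos_right hβ ha₀pos).trans_le hattain
end

section
/- Let n be a positive integer, let L = [[1,0],[1,1]] and R = [[1,1],[0,1]], and let M = [[a,b],[c,d]] be a product of n matrices each equal to L or R. Then there is no pair of positive coprime integers s, t with s ≤ n and t ≤ n such that b·t < s·d and s·c < a·t (i.e., no reduced fraction s/t with numerator and denominator at most n lies strictly inside the open interval (b/d, a/c) = M((0,∞))). -/
/-- The length of a word in the two elementary matrices `L` and `R` is smaller than one of the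
row sums of its product. -/
theorem elementary_word_prod_bounds (l : List (Matrix (Fin 2) (Fin 2) ℤ))
    (hl : ∀ A ∈ l, A = !![1, 0; 1, 1] ∨ A = !![1, 1; 0, 1]) :
    (∀ i j, 0 ≤ l.prod i j) ∧ l.prod 0 0 * l.prod 1 1 - l.prod 0 1 * l.prod 1 0 = 1 ∧
      1 ≤ l.prod 0 0 + l.prod 0 1 ∧ 1 ≤ l.prod 1 0 + l.prod 1 1 ∧
      ((l.length : ℤ) < l.prod 0 0 + l.prod 0 1 ∨
        (l.length : ℤ) < l.prod 1 0 + l.prod 1 1) := by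
  induction l with
  | nil => simp [Fin.forall_fin_two]
  | cons A l ih =>
    obtain ⟨hpos, hdet, htop, hbot, hlen⟩ := ih fun B hB => hl B (List.mem_cons_of_mem _ hB)
    simp only [Fin.forall_fin_two] at hpos ⊢
    obtain ⟨⟨ha, hb⟩, hc, hd⟩ := hpos
    rcases hl A List.mem_cons_self with rfl | rfl <;>
      simp only [List.prod_cons, List.length_cons, Matrix.mul_apply, Fin.sum_univ_two,
        Matrix.of_apply, Matrix.cons_val', Matrix.cons_val_zero, Matrix.cons_val_one,
        Matrix.cons_val_fin_one, one_mul, zero_mul, add_zero, zero_add, Nat.cast_add,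
        Nat.cast_one] <;>
      refine ⟨⟨⟨?_, ?_⟩, ?_, ?_⟩, by linarith, ?_, ?_, ?_⟩ <;> omega

theorem stmt_13 (n : ℕ) (f : Fin n → Matrix (Fin 2) (Fin 2) ℤ)
    (hf : ∀ i, f i = !![1, 0; 1, 1] ∨ f i = !![1, 1; 0, 1])
    (M : Matrix (Fin 2) (Fin 2) ℤ) (hM : M = (List.ofFn f).prod) :
    ¬ ∃ s t : ℤ, 0 < s ∧ 0 < t ∧ IsCoprime s t ∧ s ≤ (n : ℤ) ∧ t ≤ (n : ℤ) ∧
      M 0 1 * t < s * M 1 1 ∧ s * M 1 0 < M 0 0 * t := by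
  rintro ⟨s, t, -, -, -, hs, ht, hlow, hupp⟩
  obtain ⟨hpos, hdet, -, -, hlen⟩ := elementary_word_prod_bounds (List.ofFn f) (by
    intro A hA
    obtain ⟨i, rfl⟩ := List.mem_ofFn.mp hA
    exact hf i)
  rw [List.length_ofFn] at hlen
  rw [← hM] at hpos hdet hlen
  have hu : 0 ≤ s * M 1 1 - M 0 1 * t - 1 := by linarith
  have hv : 0 ≤ M 0 0 * t - s * M 1 0 - 1 := by linarith
  have hs' : M 0 0 + M 0 1 ≤ s := by
    linear_combination mul_nonneg (hpos 0 0) hu + mul_nonneg (hpos 0 1) hv + s * hdet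
  have ht' : M 1 0 + M 1 1 ≤ t := by
    linear_combination mul_nonneg (hpos 1 0) hu + mul_nonneg (hpos 1 1) hv + t * hdet
  omega
end
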